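/- Let N = N_A + N_B and let S be a stabilizer group on N qubits with |S| = 2^N, so that ρ := 2^{-N} • ∑_{g ∈ S} g is the density matrix of the corresponding stabilizer state. Let S_A := {h ∈ 𝒫_{N_A} : h ⊗ 1_{2^{N_B}} ∈ S} (Kronecker product with the identity on the B qubits), which is a stabilizer group on N_A qubits; suppose |S_A| = 2^{k_A}. Then the partial trace of ρ over the B qubits equals 2^{-(N_A - k_A)} • P_{S_A}, where P_{S_A} := 2^{-k_A} • ∑_{h ∈ S_A} h; in particular the reduced density matrix ρ_A is 2^{k_A - N_A} times an orthogonal projection of rank 2^{N_A - k_A}. -/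

import Mathlib

open Matrix Kronecker

/-- The four Pauli matrices: `σ⁰ = 1`, `σ¹ = X`, `σ² = Y`, `σ³ = Z`. -/
noncomputable def pauli : Fin 4 → Matrix (Fin 2) (Fin 2) ℂ :=
  ![1, !![0, 1; 1, 0], !![0, -Complex.I; Complex.I, 0], !![1, 0; 0, -1]]

/-- The `N`-qubit Pauli string `Σ^μ = σ^{μ 0} ⊗ ⋯ ⊗ σ^{μ (N-1)}`. -/
noncomputable def pauliString {N : ℕ} (μ : Fin N → Fin 4) :
    Matrix (Fin N → Fin 2) (Fin N → Fin 2) ℂ :=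
  Matrix.of fun x y => ∏ i, pauli (μ i) (x i) (y i)

/-- The `N`-qubit Pauli group `𝒫_N`: matrices `c • Σ^μ` with `c ∈ {1, -1, i, -i}`. -/
def pauliGroup (N : ℕ) : Set (Matrix (Fin N → Fin 2) (Fin N → Fin 2) ℂ) :=
  { M | ∃ c ∈ ({1, -1, Complex.I, -Complex.I} : Set ℂ),
      ∃ μ : Fin N → Fin 4, M = c • pauliString μ }

/-- The Pauli group on a bipartite system of `NA + NB` qubits, with the Hilbert space
factored as `A ⊗ B`: matrices `c • (Σ^μ ⊗ₖ Σ^ν)` with `c ∈ {1, -1, i, -i}`. -/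
def pauliGroupAB (NA NB : ℕ) :
    Set (Matrix ((Fin NA → Fin 2) × (Fin NB → Fin 2))
      ((Fin NA → Fin 2) × (Fin NB → Fin 2)) ℂ) :=
  { M | ∃ c ∈ ({1, -1, Complex.I, -Complex.I} : Set ℂ),
      ∃ μ : Fin NA → Fin 4, ∃ ν : Fin NB → Fin 4,
        M = c • (pauliString μ ⊗ₖ pauliString ν) }

/-- Partial trace over the `B` factor. -/
noncomputable def ptraceB {A B : Type*} [Fintype B]
    (M : Matrix (A × B) (A × B) ℂ) : Matrix A A ℂ :=
  Matrix.of fun a a' => ∑ b, M (a, b) (a', b)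

theorem conjTranspose_pauli (m : Fin 4) : (pauli m)ᴴ = pauli m := by
  fin_cases m <;> ext i j <;> fin_cases i <;> fin_cases j <;> simp [pauli]

theorem pauli_mul_self (m : Fin 4) : pauli m * pauli m = 1 := by
  fin_cases m <;> ext i j <;> fin_cases i <;> fin_cases j <;> simp [pauli]

theorem trace_pauli (m : Fin 4) : (pauli m).trace = if m = 0 then 2 else 0 := by
  fin_cases m <;> simp [pauli, Matrix.trace_fin_two]

theorem pauliString_zero {N : ℕ} : pauliString (0 : Fin N → Fin 4) = 1 := by
  ext x y
  have h : ∀ a b, pauli 0 a b = if a = b then 1 else 0 := fun a b => by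
    simp [pauli, Matrix.one_apply]
  simp [pauliString, h, Matrix.one_apply, Finset.prod_ite_zero, funext_iff]

theorem conjTranspose_pauliString {N : ℕ} (μ : Fin N → Fin 4) :
    (pauliString μ)ᴴ = pauliString μ := by
  ext x y
  simp only [pauliString, Matrix.conjTranspose_apply, Matrix.of_apply, star_prod]
  refine Finset.prod_congr rfl fun i _ => ?_
  rw [← Matrix.conjTranspose_apply, conjTranspose_pauli]

theorem pauliString_mul_self {N : ℕ} (μ : Fin N → Fin 4) :
    pauliString μ * pauliString μ = 1 := by
  rw [← pauliString_zero]
  ext x y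
  simp only [pauliString, Matrix.mul_apply, Matrix.of_apply, ← Finset.prod_mul_distrib]
  rw [← Fintype.prod_sum fun i b => pauli (μ i) (x i) b * pauli (μ i) b (y i)]
  refine Finset.prod_congr rfl fun i _ => ?_
  rw [← Matrix.mul_apply, pauli_mul_self]
  simp [pauli]

theorem trace_pauliString {N : ℕ} (μ : Fin N → Fin 4) :
    (pauliString μ).trace = if μ = 0 then 2 ^ N else 0 := by
  have h : (pauliString μ).trace = ∏ i, (pauli (μ i)).trace := by
    simp only [Matrix.trace, pauliString, Matrix.diag_apply, Matrix.of_apply]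
    rw [Fintype.prod_sum fun i b => pauli (μ i) b b]
  simp only [h, trace_pauli, Finset.prod_ite_zero, funext_iff]
  simp

section PartialTrace

variable {A B : Type*} [Fintype B]

theorem ptraceB_kronecker (M : Matrix A A ℂ) (K : Matrix B B ℂ) :
    ptraceB (M ⊗ₖ K) = K.trace • M := by
  ext a a'
  simp [ptraceB, Matrix.trace, Finset.mul_sum, mul_comm]

theorem ptraceB_smul (c : ℂ) (M : Matrix (A × B) (A × B) ℂ) :
    ptraceB (c • M) = c • ptraceB M := by
  ext a a'
  simp [ptraceB, Finset.mul_sum]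

theorem ptraceB_sum {ι : Type*} (s : Finset ι) (f : ι → Matrix (A × B) (A × B) ℂ) :
    ptraceB (∑ i ∈ s, f i) = ∑ i ∈ s, ptraceB (f i) := by
  ext a a'
  simp only [ptraceB, Matrix.sum_apply, Matrix.of_apply]
  exact Finset.sum_comm

theorem kronecker_one_injective [DecidableEq B] [Nonempty B] :
    Function.Injective fun M : Matrix A A ℂ => M ⊗ₖ (1 : Matrix B B ℂ) := by
  intro M K h
  have h' := congrArg ptraceB h
  simp only [ptraceB_kronecker, Matrix.trace_one] at h'
  exact smul_right_injective _ (Nat.cast_ne_zero.mpr Fintype.card_ne_zero) h'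

end PartialTrace

/-- The rank of an idempotent complex matrix is its trace. -/
theorem Matrix.cast_rank_eq_trace_of_isIdempotentElem {n : Type*} [Fintype n] [DecidableEq n]
    {P : Matrix n n ℂ} (hP : P * P = P) : (P.rank : ℂ) = P.trace := by
  have hid : IsIdempotentElem P.toLin' := by
    rw [IsIdempotentElem, Module.End.mul_eq_comp, ← Matrix.toLin'_mul, hP]
  rw [← Matrix.trace_toLin'_eq, (LinearMap.IsIdempotentElem.isProj_range _ hid).trace]
  rfl

/-- A Pauli group element squares to `±1`. -/
theorem mul_self_of_mem_pauliGroupAB {NA NB : ℕ}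
    {g : Matrix ((Fin NA → Fin 2) × (Fin NB → Fin 2)) ((Fin NA → Fin 2) × (Fin NB → Fin 2)) ℂ}
    (hg : g ∈ pauliGroupAB NA NB) : g * g = 1 ∨ g * g = -1 := by
  obtain ⟨c, hc, μ, ν, rfl⟩ := hg
  have hsq : (c • (pauliString μ ⊗ₖ pauliString ν)) * (c • (pauliString μ ⊗ₖ pauliString ν))
      = (c * c) • 1 := by
    rw [smul_mul_smul_comm, ← Matrix.mul_kronecker_mul, pauliString_mul_self,
      pauliString_mul_self, Matrix.one_kronecker_one]
  rw [hsq]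
  rcases hc with rfl | rfl | rfl | rfl <;> simp

/-- If `h ⊗ 1` is a Pauli group element and `h` squares to `1`, then `h`
is a Pauli group element. -/
theorem mem_pauliGroup_of_kronecker_one_mem {NA NB : ℕ}
    {h : Matrix (Fin NA → Fin 2) (Fin NA → Fin 2) ℂ}
    (hh : h ⊗ₖ (1 : Matrix (Fin NB → Fin 2) (Fin NB → Fin 2) ℂ) ∈ pauliGroupAB NA NB)
    (hsq : h * h = 1) : h ∈ pauliGroup NA := by
  obtain ⟨c, hc, μ, ν, e⟩ := hh
  have e' := congrArg ptraceB e
  rw [ptraceB_smul, ptraceB_kronecker, ptraceB_kronecker, trace_pauliString,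
    ← pauliString_zero, trace_pauliString, if_pos rfl] at e'
  have h2 : (2 : ℂ) ^ NB ≠ 0 := pow_ne_zero _ two_ne_zero
  by_cases hν : ν = 0
  · rw [if_pos hν, smul_comm] at e'
    exact ⟨c, hc, μ, smul_right_injective _ h2 e'⟩
  · rw [if_neg hν, zero_smul, smul_zero, smul_eq_zero_iff_right h2] at e'
    rw [e', mul_zero] at hsq
    exact absurd hsq zero_ne_one

theorem sum_mul_sum_of_mul_self_eq_one {R : Type*} [Ring R] {G : Finset R}
    (hmul : ∀ g ∈ G, ∀ h ∈ G, g * h ∈ G) (hsq : ∀ g ∈ G, g * g = 1) :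
    (∑ g ∈ G, g) * ∑ h ∈ G, h = G.card • ∑ g ∈ G, g := by
  rw [Finset.sum_mul, ← Finset.sum_const]
  refine Finset.sum_congr rfl fun g hg => ?_
  rw [Finset.mul_sum]
  refine Finset.sum_nbij' (g * ·) (g * ·) (hmul g hg) (hmul g hg) ?_ ?_ fun _ _ => rfl
  all_goals
    intro h _
    simp [← mul_assoc, hsq g hg]

theorem eq_one_or_eq_neg_one_of_smul_mul_self {R : Type*} [Ring R] [Algebra ℂ R] [Nontrivial R]
    {c : ℂ} {M : R} (hM : M * M = 1) (h : (c • M) * (c • M) = 1) : c = 1 ∨ c = -1 := by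
  rw [smul_mul_smul_comm, hM, ← Algebra.algebraMap_eq_smul_one] at h
  exact mul_self_eq_one_iff.mp ((algebraMap ℂ R).injective (h.trans (map_one _).symm))

/-- Reduced density matrix of a stabilizer state: if `S` is a stabilizer group on
`N = NA + NB` qubits with `|S| = 2^N`, `ρ = 2^{-N} • ∑_{g ∈ S} g` the corresponding
stabilizer-state density matrix, and `S_A = {h ∈ 𝒫_{NA} | h ⊗ 1 ∈ S}` with
`|S_A| = 2^{k_A}`, then `Tr_B ρ = 2^{-(NA - kA)} • P_{S_A}` where
`P_{S_A} = 2^{-k_A} • ∑_{h ∈ S_A} h`; in particular `ρ_A` is `2^{kA - NA}` times an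
orthogonal projection of rank `2^{NA - kA}`. -/
theorem stabilizer_reduced_density_matrix {NA NB kA : ℕ} (hkA : kA ≤ NA)
    (S : Finset (Matrix ((Fin NA → Fin 2) × (Fin NB → Fin 2))
      ((Fin NA → Fin 2) × (Fin NB → Fin 2)) ℂ))
    (hSsub : (S : Set _) ⊆ pauliGroupAB NA NB)
    (hone : (1 : Matrix ((Fin NA → Fin 2) × (Fin NB → Fin 2))
      ((Fin NA → Fin 2) × (Fin NB → Fin 2)) ℂ) ∈ S)
    (hmul : ∀ g ∈ S, ∀ h ∈ S, g * h ∈ S)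
    (hinv : ∀ g ∈ S, ∃ g' ∈ S, g * g' = 1)
    (hneg : -(1 : Matrix ((Fin NA → Fin 2) × (Fin NB → Fin 2))
      ((Fin NA → Fin 2) × (Fin NB → Fin 2)) ℂ) ∉ S)
    (hScard : S.card = 2 ^ (NA + NB))
    (ρ : Matrix ((Fin NA → Fin 2) × (Fin NB → Fin 2))
      ((Fin NA → Fin 2) × (Fin NB → Fin 2)) ℂ)
    (hρ : ρ = ((2 : ℂ) ^ (NA + NB))⁻¹ • ∑ g ∈ S, g)
    (SA : Finset (Matrix (Fin NA → Fin 2) (Fin NA → Fin 2) ℂ))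
    (hSA : ∀ h, h ∈ SA ↔ h ∈ pauliGroup NA ∧
      (h ⊗ₖ (1 : Matrix (Fin NB → Fin 2) (Fin NB → Fin 2) ℂ)) ∈ S)
    (hSAcard : SA.card = 2 ^ kA)
    (PA : Matrix (Fin NA → Fin 2) (Fin NA → Fin 2) ℂ)
    (hPA : PA = ((2 : ℂ) ^ kA)⁻¹ • ∑ h ∈ SA, h) :
    ptraceB ρ = ((2 : ℂ) ^ (NA - kA))⁻¹ • PA ∧
      PAᴴ = PA ∧ PA * PA = PA ∧ PA.rank = 2 ^ (NA - kA) := by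
  have hsqS : ∀ g ∈ S, g * g = 1 := fun g hg =>
    (mul_self_of_mem_pauliGroupAB (hSsub hg)).resolve_right fun e => hneg (e ▸ hmul g hg g hg)
  have hinj := kronecker_one_injective (A := Fin NA → Fin 2) (B := Fin NB → Fin 2)
  have hsqA : ∀ h, h ⊗ₖ (1 : Matrix (Fin NB → Fin 2) (Fin NB → Fin 2) ℂ) ∈ S → h * h = 1 := by
    intro h hh
    apply hinj
    have := hsqS _ hh
    rwa [← Matrix.mul_kronecker_mul, one_mul, ← Matrix.one_kronecker_one] at this
  have hmemA : ∀ h, h ∈ SA ↔ h ⊗ₖ (1 : Matrix (Fin NB → Fin 2) (Fin NB → Fin 2) ℂ) ∈ S :=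
    fun h => (hSA h).trans ⟨fun hh => hh.2, fun hh =>
      ⟨mem_pauliGroup_of_kronecker_one_mem (hSsub hh) (hsqA h hh), hh⟩⟩
  have hsq : ∀ h ∈ SA, h * h = 1 := fun h hh => hsqA h ((hmemA h).1 hh)
  have hmulA : ∀ g ∈ SA, ∀ h ∈ SA, g * h ∈ SA := by
    intro g hg h hh
    have := hmul _ ((hmemA g).1 hg) _ ((hmemA h).1 hh)
    rw [← Matrix.mul_kronecker_mul, one_mul] at this
    exact (hmemA _).2 this
  have hsign : ∀ h ∈ SA, ∃ c : ℂ, (c = 1 ∨ c = -1) ∧ ∃ μ, h = c • pauliString μ := by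
    intro h hh
    obtain ⟨c, -, μ, rfl⟩ := ((hSA h).1 hh).1
    exact ⟨c, eq_one_or_eq_neg_one_of_smul_mul_self (pauliString_mul_self μ) (hsq _ hh), μ, rfl⟩
  have hnegA : (-1 : Matrix (Fin NA → Fin 2) (Fin NA → Fin 2) ℂ) ∉ SA := by
    intro h
    rw [hmemA, ← neg_one_smul ℂ (1 : Matrix (Fin NA → Fin 2) (Fin NA → Fin 2) ℂ),
      Matrix.smul_kronecker, Matrix.one_kronecker_one, neg_one_smul] at h
    exact hneg h
  have honeA : (1 : Matrix (Fin NA → Fin 2) (Fin NA → Fin 2) ℂ) ∈ SA := by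
    rwa [hmemA, Matrix.one_kronecker_one]
  have hk : (2 : ℂ) ^ kA ≠ 0 := pow_ne_zero _ two_ne_zero
  have htrace : (∑ h ∈ SA, h).trace = 2 ^ NA := by
    rw [Matrix.trace_sum, Finset.sum_eq_single_of_mem 1 honeA, ← pauliString_zero,
      trace_pauliString, if_pos rfl]
    intro h hh hne
    obtain ⟨c, hc, μ, rfl⟩ := hsign h hh
    rw [Matrix.trace_smul, trace_pauliString]
    split_ifs with hμ
    · subst hμ
      rw [pauliString_zero] at hh hne
      rcases hc with rfl | rfl
      · simp at hne
      · exact absurd (by simpa using hh) hnegA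
    · exact smul_zero c
  have hptrace : ∑ g ∈ S, ptraceB g = (2 : ℂ) ^ NB • ∑ h ∈ SA, h := by
    classical
    rw [← Finset.sum_subset (s₁ := SA.image fun h =>
      h ⊗ₖ (1 : Matrix (Fin NB → Fin 2) (Fin NB → Fin 2) ℂ)), Finset.sum_image hinj.injOn,
      Finset.smul_sum]
    · refine Finset.sum_congr rfl fun h _ => ?_
      rw [ptraceB_kronecker, ← pauliString_zero, trace_pauliString, if_pos rfl]
    · exact Finset.image_subset_iff.2 fun h hh => (hmemA h).1 hh
    · intro g hg hne
      obtain ⟨c, -, μ, ν, rfl⟩ := hSsub hg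
      rw [ptraceB_smul, ptraceB_kronecker, trace_pauliString]
      split_ifs with hν
      · subst hν
        rw [pauliString_zero, ← Matrix.smul_kronecker] at hg hne
        exact absurd (Finset.mem_image_of_mem _ ((hmemA _).2 hg)) hne
      · rw [zero_smul, smul_zero]
  have hidem : PA * PA = PA := by
    rw [hPA, smul_mul_smul_comm, sum_mul_sum_of_mul_self_eq_one hmulA hsq, hSAcard,
      ← Nat.cast_smul_eq_nsmul ℂ, smul_smul]
    congr 1
    push_cast
    field_simp
  have hpow : (2 : ℂ) ^ NA = 2 ^ (NA - kA) * 2 ^ kA := by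
    rw [← pow_add, Nat.sub_add_cancel hkA]
  refine ⟨?_, ?_, hidem, ?_⟩
  · rw [hρ, ptraceB_smul, ptraceB_sum, hptrace, hPA, smul_smul, smul_smul]
    congr 1
    rw [pow_add, hpow]
    field_simp
  · rw [hPA, Matrix.conjTranspose_smul, Matrix.conjTranspose_sum]
    congr 1
    · simp
    · refine Finset.sum_congr rfl fun h hh => ?_
      obtain ⟨c, hc, μ, rfl⟩ := hsign h hh
      rw [Matrix.conjTranspose_smul, conjTranspose_pauliString]
      rcases hc with rfl | rfl <;> simp
  · have h := Matrix.cast_rank_eq_trace_of_isIdempotentElem hidem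
    rw [hPA, Matrix.trace_smul, htrace, ← hPA, hpow, smul_eq_mul, mul_comm,
      mul_inv_cancel_right₀ hk] at h
    exact_mod_cast h
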